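/- Let (W,S) be a Coxeter system, t ∈ S, w ∈ W_{S∖{t}}, and v ∈ W such that the product w·t·v is reduced (i.e. ℓ(wtv) = ℓ(w) + 1 + ℓ(v)). Suppose there exists r ∈ S with r in the support of w, r not in the support of v, and (rt)^2 ≠ 1 (r and t do not commute). Then in every reduced expression for wtv, every occurrence of r appears to the left of every occurrence of t. -/

import Mathlib

open CoxeterSystem List

/-- A Coxeter matrix is *even* if every off-diagonal entry is even
(the entry `0`, denoting `∞`, counts as even, i.e. is also allowed). -/
def CoxeterMatrix.IsEven {B : Type*} (M : CoxeterMatrix B) : Prop :=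
  ∀ i i' : B, i ≠ i' → Even (M i i')

/-- The standard parabolic subgroup `W_T` generated by the simple reflections in `T`. -/
def CoxeterSystem.parabolic {B W : Type*} [Group W] {M : CoxeterMatrix B}
    (cs : CoxeterSystem M W) (T : Set B) : Subgroup W :=
  Subgroup.closure (cs.simple '' T)

/-- A subset `T` of generators is *spherical* if the parabolic subgroup `W_T` is finite. -/
def CoxeterSystem.IsSpherical {B W : Type*} [Group W] {M : CoxeterMatrix B}
    (cs : CoxeterSystem M W) (T : Set B) : Prop :=
  (cs.parabolic T : Set W).Finite

/-- The support of `w`: the set of generators occurring in a reduced expression for `w`. -/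
def CoxeterSystem.support {B W : Type*} [Group W] {M : CoxeterMatrix B}
    (cs : CoxeterSystem M W) (w : W) : Set B :=
  {i | ∃ ω : List B, cs.IsReduced ω ∧ cs.wordProd ω = w ∧ i ∈ ω}


section Aux8

/-- Linear form of the geometric representation. -/
noncomputable def geomForm8 {B : Type*} (M : CoxeterMatrix B) (i : B) : Module.Dual ℝ (B →₀ ℝ) :=
  Finsupp.linearCombination ℝ (fun j => -2 * Real.cos (Real.pi / (M i j : ℝ)))

theorem geomForm8_single {B : Type*} (M : CoxeterMatrix B) (i j : B) :
    geomForm8 M i (Finsupp.single j 1) = -2 * Real.cos (Real.pi / (M i j : ℝ)) := by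
  simp [geomForm8]

theorem geomForm8_self {B : Type*} (M : CoxeterMatrix B) (i : B) :
    geomForm8 M i (Finsupp.single i 1) = 2 := by
  rw [geomForm8_single]; simp

theorem geom8_liftable {B : Type*} (M : CoxeterMatrix B) :
    M.IsLiftable (fun i => Module.reflection (geomForm8_self M i)) := by
  intro i j
  have hsymm : M j i = M i j := M.symmetric j i
  have hx := geomForm8_single M j i
  have hy := geomForm8_single M i j
  rw [hsymm] at hx
  ext1 z
  by_cases h0 : M i j = 0
  · rw [h0]; simp
  by_cases h1 : M i j = 1
  · have : i = j := by
      by_contra h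
      exact M.off_diagonal i j h h1
    subst this
    rw [h1, pow_one, LinearEquiv.mul_apply]
    exact Module.involutive_reflection (geomForm8_self M i) z
  by_cases h2 : M i j = 2
  · rw [h2] at hx hy ⊢
    simp at hx hy
    have hi := geomForm8_self M i
    have hj := geomForm8_self M j
    simp only [pow_two, LinearEquiv.mul_apply, Module.reflection_apply, map_sub, map_smul, hx, hy,
      hi, hj, LinearEquiv.coe_one, id]
    module
  have h3 : 3 ≤ M i j := by omega
  set m := M i j with hm
  have hm0 : (0 : ℝ) < m := by positivity
  have hm3 : (3 : ℝ) ≤ m := by exact_mod_cast h3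
  have ht : 2 * Real.cos (2 * (Real.pi / m)) =
      geomForm8 M i (Finsupp.single j 1) * geomForm8 M j (Finsupp.single i 1) - 2 := by
    rw [hx, hy, Real.cos_two_mul]; ring
  rw [Module.reflection_mul_reflection_pow_apply _ _ m z _ ht]
  set θ := 2 * (Real.pi / m) with hθ
  have hs : Real.sin θ ≠ 0 := by
    apply ne_of_gt
    apply Real.sin_pos_of_pos_of_lt_pi
    · positivity
    · rw [hθ, ← mul_div_assoc, div_lt_iff₀ hm0]
      nlinarith [Real.pi_pos]
  have hS : ∀ n : ℤ, (Polynomial.Chebyshev.S ℝ n).eval (2 * Real.cos θ) =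
      Real.sin ((n + 1) * θ) / Real.sin θ := fun n => by
    rw [eq_div_iff hs]; exact Polynomial.Chebyshev.S_two_mul_real_cos θ n
  have key : (((Polynomial.Chebyshev.S ℝ (((m : ℤ) - 1) / 2)).eval (2 * Real.cos θ) = 0 ∧
      (Polynomial.Chebyshev.S ℝ (((m : ℤ) - 2) / 2)).eval (2 * Real.cos θ) = 0)) ∨
      ((Polynomial.Chebyshev.S ℝ (((m : ℤ) - 1) / 2)).eval (2 * Real.cos θ) +
        (Polynomial.Chebyshev.S ℝ (((m : ℤ) - 3) / 2)).eval (2 * Real.cos θ) = 0 ∧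
      (Polynomial.Chebyshev.S ℝ ((m : ℤ) / 2)).eval (2 * Real.cos θ) +
        (Polynomial.Chebyshev.S ℝ (((m : ℤ) - 2) / 2)).eval (2 * Real.cos θ) = 0) := by
    rcases Nat.even_or_odd' m with ⟨k, hk | hk⟩
    · left
      have e1 : ((m : ℤ) - 1) / 2 = k - 1 := by omega
      have e2 : ((m : ℤ) - 2) / 2 = k - 1 := by omega
      have hk' : (m : ℝ) = 2 * k := by exact_mod_cast hk
      have : (((k : ℤ) - 1 : ℤ) + 1 : ℝ) * θ = Real.pi := by
        have : (k : ℝ) ≠ 0 := by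
          intro h; rw [h] at hk'; linarith
        rw [hθ, hk']; push_cast; field_simp; ring
      rw [e1, e2, hS, this]; simp
    · right
      have e1 : ((m : ℤ) - 1) / 2 = k := by omega
      have e2 : ((m : ℤ) - 2) / 2 = k - 1 := by omega
      have e3 : ((m : ℤ) - 3) / 2 = k - 1 := by omega
      have e4 : (m : ℤ) / 2 = k := by omega
      have hk' : (m : ℝ) = 2 * k + 1 := by exact_mod_cast hk
      have hk'' : (2 * k + 1 : ℝ) ≠ 0 := by positivity
      have a1 : (((k : ℤ) : ℝ) + 1 : ℝ) * θ = Real.pi / m + Real.pi := by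
        rw [hθ, hk']; push_cast; field_simp; ring
      have a2 : (((k : ℤ) - 1 : ℤ) + 1 : ℝ) * θ = Real.pi - Real.pi / m := by
        rw [hθ, hk']; push_cast; field_simp; ring
      have : Real.sin ((((k : ℤ) : ℝ) + 1 : ℝ) * θ) / Real.sin θ +
          Real.sin ((((k : ℤ) - 1 : ℤ) + 1 : ℝ) * θ) / Real.sin θ = 0 := by
        rw [a1, a2, Real.sin_add_pi, Real.sin_pi_sub]; ring
      rw [e1, e2, e3, e4, hS, hS]
      exact ⟨this, this⟩
  rcases key with ⟨k1, k2⟩ | ⟨k1, k2⟩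
  · rw [k1, k2]; simp
  · rw [k1, k2]; simp

variable {B W : Type*} [Group W] {M : CoxeterMatrix B} (cs : CoxeterSystem M W)

theorem simple_inj8 {i j : B} (h : cs.simple i = cs.simple j) : i = j := by
  by_contra hij
  have h1 := cs.lift_apply_simple (geom8_liftable M) i
  have h2 := cs.lift_apply_simple (geom8_liftable M) j
  rw [h] at h1
  have h3 := h1.symm.trans h2
  have h4 := congrArg (fun e => (e (Finsupp.single i 1)) i) h3
  simp only [Module.reflection_apply, geomForm8_self] at h4
  simp [Ne.symm hij] at h4

open Classical in
/-- The signed permutation action. -/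
noncomputable def eta8 (i : B) : Function.End (W × ZMod 2) :=
  fun p => (cs.simple i * p.1 * cs.simple i, p.2 + if p.1 = cs.simple i then 1 else 0)

open Classical in
theorem eta8_pow (i j : B) (n : ℕ) (w : W) (e : ZMod 2) :
    ((eta8 cs i * eta8 cs j) ^ n) (w, e) =
      ((cs.simple i * cs.simple j) ^ n * w * (cs.simple j * cs.simple i) ^ n,
        e + ∑ k ∈ Finset.range (2 * n),
          if w = (cs.simple j * cs.simple i) ^ k * cs.simple j then 1 else 0) := by
  induction n with
  | zero => simp; rfl
  | succ n ih =>
    rw [pow_succ']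
    change (eta8 cs i) ((eta8 cs j) (((eta8 cs i * eta8 cs j) ^ n) (w, e))) = _
    rw [ih]
    have hinv : ((cs.simple i * cs.simple j) ^ n)⁻¹ = (cs.simple j * cs.simple i) ^ n := by
      rw [← inv_pow]; simp
    have hc : cs.simple j * (cs.simple i * cs.simple j) ^ n =
        (cs.simple j * cs.simple i) ^ n * cs.simple j := by
      clear ih hinv
      induction n with
      | zero => simp
      | succ n ih => rw [pow_succ', pow_succ', mul_assoc (cs.simple j * cs.simple i), ← ih]; simp only [mul_assoc]
    have c1 : ((cs.simple i * cs.simple j) ^ n * w * (cs.simple j * cs.simple i) ^ n = cs.simple j) ↔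
        w = (cs.simple j * cs.simple i) ^ (2 * n) * cs.simple j := by
      rw [← hinv, mul_inv_eq_iff_eq_mul, ← eq_inv_mul_iff_mul_eq, hc, hinv, two_mul, pow_add,
        mul_assoc]
    have c2 : (cs.simple j * ((cs.simple i * cs.simple j) ^ n * w * (cs.simple j * cs.simple i) ^ n)
        * cs.simple j = cs.simple i) ↔
        w = (cs.simple j * cs.simple i) ^ (2 * n + 1) * cs.simple j := by
      rw [← hinv, ← eq_mul_inv_iff_mul_eq, ← eq_inv_mul_iff_mul_eq, mul_inv_eq_iff_eq_mul,
        ← eq_inv_mul_iff_mul_eq, cs.inv_simple, mul_assoc (cs.simple j), mul_assoc (cs.simple i), hc,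
        hinv, show 2 * n + 1 = n + (1 + n) by ring, pow_add _ n, pow_add _ 1, pow_one]
      simp only [mul_assoc]
    simp only [eta8, c1, c2]
    rw [show 2 * (n + 1) = 2 * n + 1 + 1 by ring, Finset.sum_range_succ, Finset.sum_range_succ]
    ext
    · dsimp only
      rw [pow_succ', pow_succ]
      simp only [mul_assoc]
    · dsimp only
      simp only [add_assoc]

theorem eta8_liftable : M.IsLiftable (eta8 cs) := by
  classical
  intro i j
  funext ⟨w, e⟩
  rw [eta8_pow]
  have h1 : (cs.simple i * cs.simple j) ^ M i j = 1 := cs.simple_mul_simple_pow i j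
  have h2 : (cs.simple j * cs.simple i) ^ M i j = 1 := cs.simple_mul_simple_pow' i j
  rw [h1, h2, two_mul, Finset.sum_range_add]
  simp only [pow_add, h2, one_mul, mul_one]
  rw [CharTwo.add_self_eq_zero, add_zero]
  rfl

open Classical in
theorem eta8_word (ω : List B) (w : W) :
    (cs.lift ⟨eta8 cs, eta8_liftable cs⟩ (cs.wordProd ω)) (w, 0) =
      (cs.wordProd ω * w * (cs.wordProd ω)⁻¹, ((cs.rightInvSeq ω).count w : ZMod 2)) := by
  induction ω with
  | nil => simp; rfl
  | cons i ω ih =>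
    rw [cs.wordProd_cons, map_mul, cs.lift_apply_simple]
    change (eta8 cs i) _ = _
    rw [ih]
    simp only [eta8, CoxeterSystem.rightInvSeq, List.count_cons]
    have : ((cs.wordProd ω)⁻¹ * cs.simple i * cs.wordProd ω = w) ↔
        (cs.wordProd ω * w * (cs.wordProd ω)⁻¹ = cs.simple i) := by
      rw [mul_inv_eq_iff_eq_mul, mul_assoc, inv_mul_eq_iff_eq_mul, eq_comm]
    ext
    · simp [mul_assoc]
    · simp only [beq_iff_eq, this]
      push_cast
      simp

/-- The exchange condition on the right. -/
theorem exchangeR8 {ω : List B} {s : B}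
    (hs : cs.length (cs.wordProd ω * cs.simple s) < cs.length (cs.wordProd ω)) :
    ∃ a i b, ω = a ++ i :: b ∧ cs.wordProd ω * cs.simple s = cs.wordProd (a ++ b) := by
  classical
  have hmem : cs.simple s ∈ cs.rightInvSeq ω := by
    by_contra hn
    have h1 := eta8_word cs ω (cs.simple s)
    rw [List.count_eq_zero_of_not_mem hn] at h1
    obtain ⟨ω', hr, hp⟩ := cs.exists_isReduced (cs.wordProd ω * cs.simple s)
    have hp' : cs.wordProd ω = cs.wordProd (ω'.concat s) := by
      rw [cs.wordProd_concat, ← hp]; simp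
    have hred : cs.IsReduced (ω'.concat s) := by
      unfold CoxeterSystem.IsReduced
      rw [← hp']
      have hl : cs.length (cs.wordProd ω * cs.simple s) = ω'.length := by rw [hp]; exact hr
      have := cs.length_mul_simple (cs.wordProd ω) s
      simp only [List.length_concat]
      omega
    have h2 := eta8_word cs (ω'.concat s) (cs.simple s)
    rw [List.count_eq_one_of_mem hred.nodup_rightInvSeq (by
      rw [cs.rightInvSeq_concat]; simp), ← hp', h1] at h2
    have := congrArg Prod.snd h2
    simp at this
  obtain ⟨j, hj, he⟩ := List.mem_iff_getElem.mp hmem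
  have hj' : j < ω.length := by simpa using hj
  have h := cs.wordProd_mul_getD_rightInvSeq ω j
  rw [List.getD_eq_getElem _ _ hj, he] at h
  refine ⟨ω.take j, ω[j], ω.drop (j + 1), by simp, ?_⟩
  rw [h, List.eraseIdx_eq_take_drop_succ]

/-- The exchange condition on the left. -/
theorem exchangeL8 {ω : List B} {s : B}
    (hs : cs.length (cs.simple s * cs.wordProd ω) < cs.length (cs.wordProd ω)) :
    ∃ a i b, ω = a ++ i :: b ∧ cs.simple s * cs.wordProd ω = cs.wordProd (a ++ b) := by
  obtain ⟨a, i, b, h1, h2⟩ := exchangeR8 cs (ω := ω.reverse) (s := s) (by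
    rw [cs.wordProd_reverse, cs.length_inv, ← cs.length_inv]; simpa using hs)
  refine ⟨b.reverse, i, a.reverse, ?_, ?_⟩
  · rw [← List.reverse_reverse ω, h1]; simp
  · rw [← List.reverse_append, cs.wordProd_reverse, ← h2]; simp

theorem deletion8 (ω : List B) :
    ∃ ω' : List B, ω'.Sublist ω ∧ cs.IsReduced ω' ∧ cs.wordProd ω' = cs.wordProd ω := by
  induction ω with
  | nil => exact ⟨[], List.Sublist.refl _, by simp [CoxeterSystem.IsReduced], rfl⟩
  | cons s ω ih =>
    obtain ⟨ω', hsub, hred, hp⟩ := ih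
    rcases cs.length_simple_mul (cs.wordProd ω') s with h | h
    · refine ⟨s :: ω', hsub.cons_cons s, ?_, by rw [cs.wordProd_cons, cs.wordProd_cons, hp]⟩
      unfold CoxeterSystem.IsReduced
      rw [cs.wordProd_cons, h, hred.eq]; simp
    · obtain ⟨a, i, b, h1, h2⟩ := exchangeL8 cs (ω := ω') (s := s) (by omega)
      refine ⟨a ++ b, ?_, ?_, by rw [cs.wordProd_cons, ← hp, h2]⟩
      · refine List.Sublist.cons s (List.Sublist.trans ?_ hsub)
        rw [h1]
        exact List.Sublist.append_left (List.sublist_cons_self i b) a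
      · unfold CoxeterSystem.IsReduced
        have := hred.eq
        rw [← h2]
        rw [h1] at this h ⊢
        simp only [List.length_append, List.length_cons] at *
        omega

theorem word_mem8 {T : Set B} {ω : List B} (h : ∀ i ∈ ω, i ∈ T) :
    cs.wordProd ω ∈ cs.parabolic T := by
  induction ω with
  | nil => simp
  | cons s ω ih =>
    rw [cs.wordProd_cons]
    exact mul_mem (Subgroup.subset_closure ⟨s, h s (by simp), rfl⟩)
      (ih fun i hi => h i (by simp [hi]))

theorem simple_mem8 {T : Set B} {i : B} (h : i ∈ T) : cs.simple i ∈ cs.parabolic T :=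
  Subgroup.subset_closure ⟨i, h, rfl⟩

theorem exists_word8 {T : Set B} {w : W} (h : w ∈ cs.parabolic T) :
    ∃ ω : List B, (∀ i ∈ ω, i ∈ T) ∧ cs.wordProd ω = w := by
  induction h using Subgroup.closure_induction with
  | mem x hx =>
    obtain ⟨i, hi, rfl⟩ := hx
    exact ⟨[i], by simpa using hi, by simp⟩
  | one => exact ⟨[], by simp, by simp⟩
  | mul x y _ _ hx hy =>
    obtain ⟨a, ha, rfl⟩ := hx
    obtain ⟨b, hb, rfl⟩ := hy
    refine ⟨a ++ b, ?_, by rw [cs.wordProd_append]⟩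
    intro i hi
    rcases List.mem_append.mp hi with h | h
    · exact ha i h
    · exact hb i h
  | inv x _ hx =>
    obtain ⟨a, ha, rfl⟩ := hx
    exact ⟨a.reverse, by simpa using ha, by simp⟩

theorem exists_reduced_word8 {T : Set B} {w : W} (h : w ∈ cs.parabolic T) :
    ∃ ω : List B, (∀ i ∈ ω, i ∈ T) ∧ cs.IsReduced ω ∧ cs.wordProd ω = w := by
  obtain ⟨ω, h1, h2⟩ := exists_word8 cs h
  obtain ⟨ω', h3, h4, h5⟩ := deletion8 cs ω
  exact ⟨ω', fun i hi => h1 i (h3.subset hi), h4, h5.trans h2⟩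

theorem mem_of_simple_mem8 {T : Set B} {i : B} (h : cs.simple i ∈ cs.parabolic T) : i ∈ T := by
  obtain ⟨ω, h1, h2, h3⟩ := exists_reduced_word8 cs h
  have hl := h2.eq
  rw [h3, cs.length_simple] at hl
  obtain ⟨j, rfl⟩ := List.length_eq_one_iff.mp hl.symm
  rw [cs.wordProd_singleton] at h3
  rw [← simple_inj8 cs h3]
  exact h1 j (by simp)

/-- Every reduced word of an element of a parabolic subgroup has its letters there. -/
theorem reduced_letters8 {T : Set B} {ω : List B} (hω : cs.IsReduced ω)
    (h : cs.wordProd ω ∈ cs.parabolic T) : ∀ i ∈ ω, i ∈ T := by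
  induction ω with
  | nil => simp
  | cons s ω ih =>
    have hs : s ∈ T := by
      obtain ⟨α, h1, h2, h3⟩ := exists_reduced_word8 cs h
      have hl : cs.length (cs.wordProd ω) ≤ ω.length := cs.length_wordProd_le ω
      have hl2 := hω.eq
      simp only [List.length_cons] at hl2
      obtain ⟨a, i, b, e1, e2⟩ := exchangeL8 cs (ω := α) (s := s) (by
        rw [h3, hl2, cs.wordProd_cons]; simp; omega)
      apply mem_of_simple_mem8 cs
      rw [← mul_inv_eq_iff_eq_mul.mpr e2.symm]
      refine mul_mem (word_mem8 cs ?_) (inv_mem (word_mem8 cs h1))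
      intro j hj
      apply h1 j
      rw [e1]
      simp only [List.mem_append, List.mem_cons] at hj ⊢
      tauto
    have hm : cs.wordProd ω ∈ cs.parabolic T := by
      have := mul_mem (simple_mem8 cs hs) h
      simpa [cs.wordProd_cons] using this
    have hd : cs.IsReduced ω := by simpa using hω.drop 1
    intro i hi
    rcases List.mem_cons.mp hi with rfl | hi
    · exact hs
    · exact ih hd hm i hi

/-- Additivity of length for minimal coset representatives. -/
theorem min_coset8 {T : Set B} {x : W}
    (hx : ∀ z ∈ cs.parabolic T, cs.length x ≤ cs.length (x * z)) {z : W}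
    (hz : z ∈ cs.parabolic T) : cs.length (x * z) = cs.length x + cs.length z := by
  obtain ⟨ξ, hξ, rfl⟩ := cs.exists_isReduced x
  obtain ⟨ζ, h1, h2, rfl⟩ := exists_reduced_word8 cs hz
  obtain ⟨ω, h3, h4, h5⟩ := deletion8 cs (ξ ++ ζ)
  obtain ⟨ξ', ζ', rfl, h6, h7⟩ := List.sublist_append_iff.mp h3
  have hζ' : cs.wordProd ζ' ∈ cs.parabolic T := word_mem8 cs fun i hi => h1 i (h7.subset hi)
  rw [cs.wordProd_append, cs.wordProd_append] at h5
  have hle := hx (cs.wordProd ζ * (cs.wordProd ζ')⁻¹) (mul_mem hz (inv_mem hζ'))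
  rw [← mul_assoc, ← h5, mul_inv_cancel_right] at hle
  have hl1 := cs.length_wordProd_le ξ'
  have e1 : ξ' = ξ := h6.eq_of_length_le (by rw [hξ.eq] at hle; omega)
  subst e1
  have e2 := mul_left_cancel h5
  have h8 := h4.eq
  rw [cs.wordProd_append, e2, List.length_append] at h8
  have := cs.length_wordProd_le ζ'
  have := cs.length_mul_le (cs.wordProd ξ') (cs.wordProd ζ)
  rw [e2] at *
  rw [hξ.eq] at *
  omega

theorem simple_ne_one8 (i : B) : cs.simple i ≠ 1 := by
  intro h
  have := cs.length_simple i
  rw [h, cs.length_one] at this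
  omega

theorem key8 {r t : B} (hrt : (cs.simple r * cs.simple t) ^ 2 ≠ 1) {x1 y1 : W}
    (hx1 : x1 ∈ cs.parabolic {i | i ≠ t}) (hy1 : y1 ∈ cs.parabolic {i | i ≠ r})
    (ht : cs.length (cs.simple t * (x1 * y1)) < cs.length (x1 * y1)) :
    x1 * y1 ∈ cs.parabolic {i | i ≠ r} := by
  have hne : r ≠ t := by rintro rfl; simp at hrt
  have htI : cs.simple t ∉ cs.parabolic {i | i ≠ t} := fun h => (mem_of_simple_mem8 cs h) rfl
  have hrI : cs.simple r ∈ cs.parabolic {i | i ≠ t} := simple_mem8 cs hne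
  have htJ : cs.simple t ∈ cs.parabolic {i | i ≠ r} := simple_mem8 cs hne.symm
  -- minimal representative
  obtain ⟨x, ⟨a, ha, hxa⟩, hmin⟩ : ∃ x, (∃ a ∈ cs.parabolic {i | i ≠ r}, x1 = x * a) ∧
      ∀ z ∈ cs.parabolic {i | i ≠ r}, cs.length x ≤ cs.length (x * z) := by
    let P : ℕ → Prop := fun n => ∃ x, cs.length x = n ∧ ∃ a ∈ cs.parabolic {i | i ≠ r}, x1 = x * a
    have hP : ∃ n, P n := ⟨_, x1, rfl, 1, one_mem _, by simp⟩
    classical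
    obtain ⟨x, hx, a, ha, hxa⟩ := Nat.find_spec hP
    refine ⟨x, ⟨a, ha, hxa⟩, fun z hz => ?_⟩
    rw [hx]
    exact Nat.find_min' hP ⟨x * z, rfl, z⁻¹ * a, mul_mem (inv_mem hz) ha, by rw [hxa]; group⟩
  obtain ⟨α, hα, rfl⟩ := cs.exists_isReduced x
  have hαI : ∀ i ∈ α, i ∈ {i | i ≠ t} := by
    obtain ⟨β, h1, h2, h3⟩ := exists_reduced_word8 cs ha
    have hadd := min_coset8 cs hmin ha
    have hred : cs.IsReduced (α ++ β) := by
      unfold CoxeterSystem.IsReduced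
      rw [cs.wordProd_append, h3, hadd, hα.eq, ← h3, h2.eq, List.length_append]
    have := reduced_letters8 cs hred (T := {i | i ≠ t}) (by
      rw [cs.wordProd_append, h3, ← hxa]; exact hx1)
    exact fun i hi => this i (by simp [hi])
  have hxI : cs.wordProd α ∈ cs.parabolic {i | i ≠ t} := word_mem8 cs hαI
  rw [hxa, mul_assoc] at ht ⊢
  have hy : a * y1 ∈ cs.parabolic {i | i ≠ r} := mul_mem ha hy1
  by_cases hone : cs.wordProd α = 1
  · rwa [hone, one_mul]
  exfalso
  obtain ⟨q, hq⟩ := cs.exists_rightDescent_of_ne_one hone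
  have hqr : q = r := by
    by_contra h
    have := hmin (cs.simple q) (simple_mem8 cs h)
    unfold CoxeterSystem.IsRightDescent at hq
    omega
  subst hqr
  -- exchange for `t`
  obtain ⟨β, hβ, hβr, hβp⟩ := exists_reduced_word8 cs hy
  rw [← hβp, ← cs.wordProd_append] at ht
  obtain ⟨c, i, d, e1, e2⟩ := exchangeL8 cs ht
  have hcomm : ∃ z ∈ cs.parabolic {i | i ≠ q},
      cs.simple t * cs.wordProd α = cs.wordProd α * z := by
    rw [cs.wordProd_append] at e2
    rcases List.append_eq_append_iff.mp e1 with ⟨m, h1, h2⟩ | ⟨m, h1, h2⟩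
    · -- deletion in `β`
      refine ⟨cs.wordProd (m ++ d) * (cs.wordProd β)⁻¹, ?_, ?_⟩
      · refine mul_mem (word_mem8 cs ?_) (inv_mem (word_mem8 cs hβ))
        intro j hj
        apply hβ j
        rw [h2]
        simp only [List.mem_append, List.mem_cons] at hj ⊢
        tauto
      · rw [h1, List.append_assoc, cs.wordProd_append α] at e2
        rw [← mul_assoc (cs.wordProd α), ← e2]; group
    · rcases m with _ | ⟨k, m⟩
      · simp only [List.append_nil, List.nil_append] at h1 h2
        subst h1
        refine ⟨cs.wordProd d * (cs.wordProd β)⁻¹, ?_, ?_⟩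
        · refine mul_mem (word_mem8 cs ?_) (inv_mem (word_mem8 cs hβ))
          intro j hj
          apply hβ j
          rw [← h2]
          simp [hj]
        · rw [cs.wordProd_append α] at e2
          rw [← mul_assoc (cs.wordProd α), ← e2]; group
      · exfalso
        simp only [List.cons_append, List.cons.injEq] at h2
        obtain ⟨rfl, rfl⟩ := h2
        rw [← List.append_assoc, cs.wordProd_append (c ++ m), ← mul_assoc] at e2
        have e3 := mul_right_cancel e2
        apply htI
        rw [← mul_inv_eq_iff_eq_mul.mpr e3.symm]
        refine mul_mem (word_mem8 cs ?_) (inv_mem hxI)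
        intro j hj
        apply hαI j
        rw [h1]
        simp only [List.mem_append, List.mem_cons] at hj ⊢
        tauto
  obtain ⟨z, hz, hzc⟩ := hcomm
  have hlz := min_coset8 cs hmin hz
  rw [← hzc] at hlz
  have hlt : cs.length (cs.simple t * cs.wordProd α) ≤ cs.length (cs.wordProd α) + 1 := by
    have := cs.length_mul_le (cs.simple t) (cs.wordProd α)
    rw [cs.length_simple] at this
    omega
  have hz1 : z = cs.simple t := by
    rcases Nat.le_one_iff_eq_zero_or_eq_one.mp (show cs.length z ≤ 1 by omega) with h0 | h0
    · rw [cs.length_eq_zero_iff] at h0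
      rw [h0, mul_one] at hzc
      exact absurd (mul_eq_right.mp hzc) (simple_ne_one8 cs t)
    · obtain ⟨p, rfl⟩ := cs.length_eq_one_iff.mp h0
      by_contra hp
      apply htI
      rw [← mul_inv_eq_iff_eq_mul.mpr hzc.symm]
      refine mul_mem (mul_mem hxI (simple_mem8 cs ?_)) (inv_mem hxI)
      rintro rfl
      exact hp rfl
  subst hz1
  -- split off the last letter
  obtain ⟨α', hα', hp'⟩ := cs.exists_isReduced (cs.wordProd α * cs.simple q)
  have hxx : cs.wordProd α = cs.wordProd α' * cs.simple q := by rw [← hp']; simp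
  have hα'I : ∀ i ∈ α', i ∈ {i | i ≠ t} :=
    reduced_letters8 cs hα' (by rw [← hp']; exact mul_mem hxI hrI)
  have hw3 : cs.wordProd (α' ++ [q, t]) = cs.wordProd α * cs.simple t := by
    rw [hxx, cs.wordProd_append]; simp [cs.wordProd_cons, mul_assoc]
  have hlen : cs.length (cs.wordProd (α' ++ [q, t]) * cs.simple q) <
      cs.length (cs.wordProd (α' ++ [q, t])) := by
    rw [hw3, ← hzc, mul_assoc, hlz, cs.length_simple]
    have := cs.length_mul_le (cs.simple t) (cs.wordProd α * cs.simple q)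
    rw [cs.length_simple] at this
    unfold CoxeterSystem.IsRightDescent at hq
    omega
  obtain ⟨c, i, d, e1, e2⟩ := exchangeR8 cs hlen
  have hsq : ∀ p, cs.simple p * cs.simple p = 1 := cs.simple_mul_simple_self
  have hA : cs.simple q * cs.simple t * cs.simple q ≠ cs.simple t := by
    intro h
    apply hrt
    rw [pow_two, ← mul_assoc, h, hsq]
  have hB : cs.simple t * cs.simple q * cs.simple t ≠ cs.simple q := by
    intro h
    apply hrt
    rw [pow_two, mul_assoc, ← mul_assoc (cs.simple t), h, hsq]
  have hC : cs.simple t * cs.simple q * cs.simple t ∉ cs.parabolic {i | i ≠ t} := by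
    intro h
    obtain ⟨ω, h1, h2, h3⟩ := deletion8 cs [t, q, t]
    have h3' : cs.wordProd ω = cs.simple t * cs.simple q * cs.simple t := by
      rw [h3]; simp [cs.wordProd_cons, mul_assoc]
    have h4 := reduced_letters8 cs h2 (by rw [h3']; exact h)
    have h6 : ω = [] ∨ ω = [q] := by
      rcases List.sublist_cons_iff.mp h1 with h1 | ⟨l, rfl, _⟩
      · rcases List.sublist_cons_iff.mp h1 with h1 | ⟨l, rfl, h7⟩
        · rcases List.sublist_cons_iff.mp h1 with h1 | ⟨l, rfl, _⟩
          · left; exact List.sublist_nil.mp h1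
          · exact absurd rfl (h4 t (by simp))
        · rcases List.sublist_cons_iff.mp h7 with h7 | ⟨l, rfl, _⟩
          · right; rw [List.sublist_nil.mp h7]
          · exact absurd rfl (h4 t (by simp))
      · exact absurd rfl (h4 t (by simp))
    rcases h6 with rfl | rfl
    · rw [cs.wordProd_nil] at h3'
      apply simple_ne_one8 cs q
      have := congrArg (fun g => cs.simple t * g * cs.simple t) h3'
      simp only [mul_one, hsq] at this
      rw [this]
      simp [mul_assoc]
    · rw [cs.wordProd_singleton] at h3'
      exact hB h3'.symm
  have hP : cs.wordProd (α' ++ [q, t]) = cs.wordProd α' * (cs.simple q * cs.simple t) := by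
    rw [cs.wordProd_append]; simp [cs.wordProd_cons]
  rw [hP] at e2
  rcases List.append_eq_append_iff.mp e1 with ⟨m, h1, h2⟩ | ⟨m, h1, h2⟩
  · have hcd : cs.wordProd (m ++ d) = cs.simple q * cs.simple t * cs.simple q := by
      rw [h1, List.append_assoc, cs.wordProd_append, mul_assoc] at e2
      exact (mul_left_cancel e2).symm
    rcases m with _ | ⟨k, m⟩
    · simp only [List.nil_append, List.cons.injEq] at h2 hcd
      rw [← h2.2, cs.wordProd_singleton] at hcd
      exact hA hcd.symm
    · rcases m with _ | ⟨k', m⟩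
      · simp only [List.cons_append, List.nil_append, List.cons.injEq] at h2 hcd
        rw [← h2.1, ← h2.2.2, cs.wordProd_singleton, mul_assoc] at hcd
        have h7 := left_eq_mul.mp hcd
        apply hrt
        have h8 : cs.simple q * cs.simple t = 1 := by
          have := congrArg (·⁻¹) h7
          simpa using this
        rw [h8, one_pow]
      · simp at h2
  · have hin : ∀ m', cs.wordProd α' * (cs.simple q * cs.simple t) * cs.simple q =
        cs.wordProd (c ++ m') * (cs.simple q * cs.simple t) →
        (∀ j ∈ c ++ m', j ∈ α') → False := by
      intro m' h3 h4
      apply hC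
      have h5 : cs.simple t * cs.simple q * cs.simple t = cs.simple q *
          ((cs.wordProd α')⁻¹ * cs.wordProd (c ++ m')) * cs.simple q := by
        have h6 : (cs.wordProd α')⁻¹ * cs.wordProd (c ++ m') =
            cs.simple q * cs.simple t * cs.simple q * (cs.simple q * cs.simple t)⁻¹ := by
          rw [inv_mul_eq_iff_eq_mul, ← mul_assoc, eq_mul_inv_iff_mul_eq, ← h3]
          simp only [mul_assoc]
        rw [h6]
        simp only [mul_inv_rev, cs.inv_simple, mul_assoc, cs.simple_mul_simple_cancel_left]
        simp
      rw [h5]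
      exact mul_mem (mul_mem hrI (mul_mem (inv_mem (word_mem8 cs hα'I))
        (word_mem8 cs fun j hj => hα'I j (h4 j hj)))) hrI
    rcases m with _ | ⟨k, m⟩
    · simp only [List.append_nil, List.nil_append, List.cons.injEq] at h1 h2
      rw [← h1, h2.2, cs.wordProd_append, mul_assoc, cs.wordProd_singleton] at e2
      exact hA (mul_left_cancel e2)
    · simp only [List.cons_append, List.cons.injEq] at h2
      refine hin m ?_ ?_
      · rw [e2, h2.2, ← List.append_assoc, cs.wordProd_append (c ++ m)]
        simp [cs.wordProd_cons]
      · intro j hj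
        rw [h1]
        simp only [List.mem_append, List.mem_cons] at hj ⊢
        tauto

theorem main8 {r t : B} (hrt : (cs.simple r * cs.simple t) ^ 2 ≠ 1) (ω : List B)
    (hω : cs.IsReduced ω) (h : ∃ x ∈ cs.parabolic {i | i ≠ t}, ∃ y ∈ cs.parabolic {i | i ≠ r},
      cs.wordProd ω = x * y) :
    ∀ (p q : ℕ) (hp : p < ω.length) (hq : q < ω.length),
        ω[p]'hp = r → ω[q]'hq = t → p < q := by
  induction ω with
  | nil => intro p q hp; simp at hp
  | cons s ω ih =>
    intro p q hp hq hpr hqt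
    obtain ⟨x, hx, y, hy, hxy⟩ := h
    have hd : cs.IsReduced ω := by simpa using hω.drop 1
    have hst : s ≠ t := by
      rintro rfl
      have h1 := key8 cs hrt hx hy (by
        rw [← hxy, hω.eq, cs.wordProd_cons]
        have := cs.length_wordProd_le ω
        simp; omega)
      rw [← hxy] at h1
      exact reduced_letters8 cs hω h1 r (hpr ▸ List.getElem_mem hp) rfl
    rcases q with _ | q
    · exact absurd hqt hst
    rcases p with _ | p
    · omega
    have := ih hd ⟨cs.simple s * x, mul_mem (simple_mem8 cs hst) hx, y, hy, by
      rw [mul_assoc, ← hxy, cs.wordProd_cons]; simp⟩ p q (by simpa using hp) (by simpa using hq)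
      (by simpa using hpr) (by simpa using hqt)
    omega

end Aux8

theorem stmt_8 {B W : Type*} [Group W] {M : CoxeterMatrix B} (cs : CoxeterSystem M W)
    (t : B) (w v : W) (hw : w ∈ cs.parabolic {i : B | i ≠ t})
    (hred : cs.length (w * cs.simple t * v) = cs.length w + 1 + cs.length v)
    (r : B) (hr : r ∈ cs.support w) (hrv : r ∉ cs.support v)
    (hrt : (cs.simple r * cs.simple t) ^ 2 ≠ 1) :
    ∀ ω : List B, cs.IsReduced ω → cs.wordProd ω = w * cs.simple t * v →
      ∀ (p q : ℕ) (hp : p < ω.length) (hq : q < ω.length),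
        ω[p]'hp = r → ω[q]'hq = t → p < q := by
  intro ω hω hp
  have hne : t ≠ r := by rintro rfl; simp at hrt
  obtain ⟨β, hβ, rfl⟩ := cs.exists_isReduced v
  refine main8 cs hrt ω hω ⟨w, hw, cs.simple t * cs.wordProd β, mul_mem (simple_mem8 cs hne)
    (word_mem8 cs fun i hi => ?_), by rw [hp, mul_assoc]⟩
  rintro rfl
  exact hrv ⟨β, hβ, rfl, hi⟩
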